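/- Let p be a prime and let G be a finite abelian p-group with Davenport constant D(G) ≤ 2·exp(G) − 1, and write n = exp(G). Then every sequence over G of length at least D(G) + n − 1 contains a nonempty zero-sum subsequence whose length t satisfies 2n − D(G) ≤ t ≤ n; that is, η_{2n−D(G)}(G) ≤ D(G) + n − 1. -/

import Mathlib

/-- The zero-sum invariant `s_L(G)`: the smallest positive integer `ℓ` such that every
sequence (multiset) over `G` of length at least `ℓ` contains a nonempty zero-sum
subsequence whose length lies in `L`. -/
noncomputable def zsInv (G : Type*) [AddCommGroup G] (L : Set ℕ) : ℕ :=
  sInf {ℓ : ℕ | 0 < ℓ ∧ ∀ S : Multiset G, ℓ ≤ Multiset.card S →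
    ∃ T : Multiset G, T ≤ S ∧ T ≠ 0 ∧ T.sum = 0 ∧ Multiset.card T ∈ L}

/-- The Davenport constant `D(G)`. -/
noncomputable def davenport (G : Type*) [AddCommGroup G] : ℕ := zsInv G {t | 0 < t}

/-- The η-invariant `η(G) = s_{[1, exp(G)]}(G)`. -/
noncomputable def etaInv (G : Type*) [AddCommGroup G] : ℕ :=
  zsInv G {t | 0 < t ∧ t ≤ AddMonoid.exponent G}

/-- The Erdős–Ginzburg–Ziv constant `s(G) = s_{{exp(G)}}(G)`. -/
noncomputable def egzConst (G : Type*) [AddCommGroup G] : ℕ :=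
  zsInv G {AddMonoid.exponent G}

/-- `η_i(G) = s_{[i, exp(G)]}(G)`. -/
noncomputable def etaI (G : Type*) [AddCommGroup G] (i : ℕ) : ℕ :=
  zsInv G {t | i ≤ t ∧ t ≤ AddMonoid.exponent G}

/-- `ζ_i(G) = s_{[i-n,0] + nℕ⁺}(G)` where `n = exp(G)`: the invariant for zero-sum
subsequences whose length is congruent mod `n` to some residue `r` with `i ≤ r ≤ n`. -/
noncomputable def zetaI (G : Type*) [AddCommGroup G] (i : ℕ) : ℕ :=
  zsInv G {t | 0 < t ∧ ∃ r : ℕ, i ≤ r ∧ r ≤ AddMonoid.exponent G ∧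
    t % AddMonoid.exponent G = r % AddMonoid.exponent G}

/-- The binomial coefficient `(t - 1).choose a`, with the value `(-1) ^ a` at `t = 0`. -/
def predChoose (a : ℕ) : ℕ → ℤ
  | 0 => (-1) ^ a
  | t + 1 => (t.choose a : ℤ)

theorem predChoose_zero_left (t : ℕ) : predChoose 0 t = 1 := by
  cases t <;> simp [predChoose]

theorem predChoose_succ_succ (a t : ℕ) :
    predChoose (a + 1) (t + 1) = predChoose (a + 1) t + predChoose a t := by
  cases t with
  | zero => simp [predChoose, pow_succ]
  | succ t => simp [predChoose, Nat.choose_succ_succ, add_comm]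

section GroupAlgebra

variable (p : ℕ) (G : Type*) [AddCommGroup G]

/-- The augmentation ideal of the group algebra of `G` over `ZMod p`. -/
noncomputable def augIdeal : Ideal (AddMonoidAlgebra (ZMod p) G) :=
  Ideal.span (Set.range fun g : G => AddMonoidAlgebra.single g 1 - 1)

variable {G}

theorem single_sub_one_mem_augIdeal (g : G) :
    AddMonoidAlgebra.single g 1 - 1 ∈ augIdeal p G :=
  Ideal.subset_span ⟨g, rfl⟩

/-- The signed generating function of the subsequences of `S`, weighted by `predChoose a` of
their lengths. -/
noncomputable def subseqSum (a : ℕ) (S : Multiset G) : AddMonoidAlgebra (ZMod p) G :=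
  (S.powerset.map fun T => AddMonoidAlgebra.single T.sum
    (((-1) ^ T.card * predChoose a T.card : ℤ) : ZMod p)).sum

theorem subseqSum_zero_cons (g : G) (S : Multiset G) :
    subseqSum p 0 (g ::ₘ S) = (1 - AddMonoidAlgebra.single g 1) * subseqSum p 0 S := by
  rw [sub_mul, one_mul]
  simp only [subseqSum, Multiset.powerset_cons, Multiset.map_add, Multiset.sum_add,
    Multiset.map_map, ← Multiset.sum_map_mul_left, sub_eq_add_neg, ← Multiset.sum_map_neg']
  congr 3
  funext T
  simp [AddMonoidAlgebra.single_mul_single, predChoose_zero_left, pow_succ,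
    AddMonoidAlgebra.single_neg]

theorem subseqSum_succ_cons (a : ℕ) (g : G) (S : Multiset G) :
    subseqSum p (a + 1) (g ::ₘ S) = (1 - AddMonoidAlgebra.single g 1) * subseqSum p (a + 1) S
      - AddMonoidAlgebra.single g 1 * subseqSum p a S := by
  rw [sub_mul, one_mul, sub_sub, ← mul_add]
  simp only [subseqSum, Multiset.powerset_cons, Multiset.map_add, Multiset.sum_add,
    Multiset.map_map, ← Multiset.sum_map_mul_left, sub_eq_add_neg, ← Multiset.sum_map_neg',
    ← Multiset.sum_map_add]
  congr 3
  funext T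
  simp only [Function.comp_apply, Multiset.sum_cons, Multiset.card_cons,
    ← AddMonoidAlgebra.single_add, AddMonoidAlgebra.single_mul_single, one_mul,
    ← AddMonoidAlgebra.single_neg, predChoose_succ_succ]
  congr 2
  push_cast
  ring

theorem subseqSum_mem (a : ℕ) (S : Multiset G) :
    subseqSum p a S ∈ augIdeal p G ^ (S.card - a) := by
  have hmul (b : ℕ) (g : G) (S : Multiset G)
      (h : subseqSum p b S ∈ augIdeal p G ^ (S.card - b)) :
      (1 - AddMonoidAlgebra.single g 1) * subseqSum p b S ∈
        augIdeal p G ^ ((g ::ₘ S).card - b) := by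
    have h1 := Ideal.mul_mem_mul
      (neg_mem (single_sub_one_mem_augIdeal p g)) h
    rw [neg_sub, ← pow_succ'] at h1
    refine Ideal.pow_le_pow_right ?_ h1
    rw [Multiset.card_cons]
    omega
  induction S using Multiset.induction generalizing a with
  | empty => simp
  | cons g S ih =>
    cases a with
    | zero =>
      rw [subseqSum_zero_cons]
      exact hmul 0 g S (ih 0)
    | succ a =>
      rw [subseqSum_succ_cons]
      refine sub_mem (hmul _ g S (ih _)) (Ideal.mul_mem_left _ _ ?_)
      simpa using ih a

theorem sum_map_powerset_eq_zero_term {A : Type*} [AddCommMonoid A] {α : Type*}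
    (f : Multiset α → A) (S : Multiset α) (hf : ∀ T ≤ S, T ≠ 0 → f T = 0) :
    (S.powerset.map f).sum = f 0 := by
  induction S using Multiset.induction with
  | empty => simp
  | cons g S ih =>
    rw [Multiset.powerset_cons, Multiset.map_add, Multiset.sum_add, Multiset.map_map,
      ih fun T hT => hf T (hT.trans (Multiset.le_cons_self S g)), Multiset.sum_eq_zero, add_zero]
    intro x hx
    obtain ⟨T, hT, rfl⟩ := Multiset.mem_map.1 hx
    exact hf _ (Multiset.cons_le_cons g (Multiset.mem_powerset.1 hT)) (Multiset.cons_ne_zero)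

theorem exists_zero_sum_not_dvd_choose [Fact p.Prime] {d : ℕ} (hd : augIdeal p G ^ (d + 1) = ⊥)
    (a : ℕ) (S : Multiset G) (hS : d + 1 + a ≤ S.card) :
    ∃ T ≤ S, T ≠ 0 ∧ T.sum = 0 ∧ ¬ p ∣ (T.card - 1).choose a := by
  classical
  by_contra! hcon
  have hzero : subseqSum p a S = 0 := by
    have h := Ideal.pow_le_pow_right (show d + 1 ≤ S.card - a by omega) (subseqSum_mem p a S)
    rwa [hd, Ideal.mem_bot] at h
  let φ : AddMonoidAlgebra (ZMod p) G →+ ZMod p :=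
    (Finsupp.applyAddHom 0).comp AddMonoidAlgebra.coeffAddEquiv.toAddMonoidHom
  have hφ (g : G) (c : ZMod p) : φ (AddMonoidAlgebra.single g c) = if g = 0 then c else 0 :=
    Finsupp.single_apply
  have h := congrArg φ hzero
  rw [subseqSum, map_multiset_sum, Multiset.map_map, sum_map_powerset_eq_zero_term,
    map_zero] at h
  · simp [hφ, predChoose] at h
  · intro T hT hT0
    simp only [Function.comp_apply, hφ]
    split_ifs with hs
    · obtain ⟨t, ht⟩ := Nat.exists_eq_succ_of_ne_zero (mt Multiset.card_eq_zero.1 hT0)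
      have hdvd := hcon T hT hT0 hs
      rw [ht, Nat.succ_sub_one, ← ZMod.natCast_eq_zero_iff] at hdvd
      simp [ht, predChoose, hdvd]
    · rfl

variable {p}

theorem augIdeal_le_span_of_closure {ι : Type*} (b : ι → G)
    (hb : AddSubgroup.closure (Set.range b) = ⊤) :
    augIdeal p G ≤ Ideal.span (Set.range fun i => AddMonoidAlgebra.single (b i) 1 - 1) := by
  rw [augIdeal, Ideal.span_le]
  rintro _ ⟨g, rfl⟩
  have hg : g ∈ AddSubgroup.closure (Set.range b) := hb ▸ AddSubgroup.mem_top g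
  simp only [SetLike.mem_coe]
  induction hg using AddSubgroup.closure_induction with
  | mem x hx =>
    obtain ⟨i, rfl⟩ := hx
    exact Ideal.subset_span ⟨i, rfl⟩
  | zero => simp [← AddMonoidAlgebra.one_def]
  | add x y _ _ hx hy =>
    have h := add_mem (Ideal.mul_mem_left _ (AddMonoidAlgebra.single x 1) hy) hx
    rwa [mul_sub, AddMonoidAlgebra.single_mul_single, mul_one, mul_one, sub_add_sub_cancel] at h
  | neg x _ hx =>
    have h := Ideal.mul_mem_left _ (-AddMonoidAlgebra.single (-x) 1) hx
    rwa [mul_sub, neg_mul, AddMonoidAlgebra.single_mul_single, neg_add_cancel, mul_one, mul_one,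
      ← AddMonoidAlgebra.one_def, sub_neg_eq_add, neg_add_eq_sub] at h

theorem sum_pow_eq_zero {R ι : Type*} [CommSemiring R] (s : Finset ι) (x : ι → R) (m : ι → ℕ)
    (hx : ∀ i ∈ s, x i ^ (m i + 1) = 0) : (∑ i ∈ s, x i) ^ (∑ i ∈ s, m i + 1) = 0 := by
  classical
  induction s using Finset.induction_on with
  | empty => simp
  | insert i s hi ih =>
    rw [Finset.sum_insert hi, Finset.sum_insert hi]
    exact (Commute.all _ _).add_pow_eq_zero_of_add_le_succ_of_pow_eq_zero
      (hx i (Finset.mem_insert_self i s))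
      (ih fun j hj => hx j (Finset.mem_insert_of_mem hj)) (by omega)

theorem augIdeal_pow_eq_bot [Fact p.Prime] {ι : Type*} [Fintype ι] (b : ι → G) (e : ι → ℕ)
    (hb : AddSubgroup.closure (Set.range b) = ⊤) (he : ∀ i, p ^ e i • b i = 0) :
    augIdeal p G ^ (∑ i, (p ^ e i - 1) + 1) = ⊥ := by
  have hle : augIdeal p G ≤ ∑ i, Ideal.span {AddMonoidAlgebra.single (b i) 1 - 1} := by
    refine (augIdeal_le_span_of_closure b hb).trans ?_
    rw [Ideal.sum_eq_sup, Ideal.span_le]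
    rintro _ ⟨i, rfl⟩
    exact Finset.le_sup (f := fun i => Ideal.span {AddMonoidAlgebra.single (b i) (1 : ZMod p) - 1})
      (Finset.mem_univ i) (Ideal.mem_span_singleton_self _)
  refine le_bot_iff.1 ((Ideal.pow_right_mono hle _).trans (le_of_eq ?_))
  refine sum_pow_eq_zero _ _ _ fun i _ => ?_
  rw [Nat.sub_add_cancel (Nat.one_le_pow _ _ (Fact.out : p.Prime).pos), Ideal.span_singleton_pow]
  have : CharP (AddMonoidAlgebra (ZMod p) G) p := charP_of_injective_algebraMap' (ZMod p) p
  rw [sub_pow_char_pow, AddMonoidAlgebra.single_pow, he, one_pow, one_pow,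
    ← AddMonoidAlgebra.one_def, sub_self]
  simp

end GroupAlgebra

theorem Multiset.exists_le_map_eq_of_le_map {α β : Type*} {f : α → β} {s : Multiset α}
    {t : Multiset β} (h : t ≤ s.map f) : ∃ u ≤ s, u.map f = t := by
  induction s using Multiset.induction generalizing t with
  | empty => exact ⟨0, le_rfl, by simpa [eq_comm] using h⟩
  | cons a s ih =>
    rw [Multiset.map_cons] at h
    by_cases ha : f a ∈ t
    · obtain ⟨t, rfl⟩ := Multiset.exists_cons_of_mem ha
      obtain ⟨u, hu, rfl⟩ := ih ((Multiset.cons_le_cons_iff _).1 h)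
      exact ⟨a ::ₘ u, Multiset.cons_le_cons a hu, Multiset.map_cons f a u⟩
    · obtain ⟨u, hu, rfl⟩ := ih ((Multiset.le_cons_of_notMem ha).1 h)
      exact ⟨u, hu.trans (Multiset.le_cons_self s a), rfl⟩

theorem Multiset.sum_map_ite_eq_count {α R : Type*} [DecidableEq α] [AddCommMonoidWithOne R]
    (s : Multiset α) (a : α) :
    (s.map fun x => if a = x then (1 : R) else 0).sum = (s.count a : R) := by
  induction s using Multiset.induction with
  | empty => simp
  | cons b s ih =>
    rw [Multiset.map_cons, Multiset.sum_cons, ih, Multiset.count_cons]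
    split_ifs <;> simp [add_comm]

theorem choose_add_prime_pow_modEq {p : ℕ} (hp : p.Prime) {m a : ℕ} (ha : a < p ^ m) (r : ℕ) :
    (p ^ m + r).choose a ≡ r.choose a [MOD p] := by
  have := Fact.mk hp
  rw [← ZMod.natCast_eq_natCast_iff, Nat.add_choose_eq, Nat.cast_sum,
    Finset.sum_eq_single (0, a)]
  · simp
  · rintro ⟨i, j⟩ hij hne
    rw [Finset.HasAntidiagonal.mem_antidiagonal] at hij
    have hi : i ≠ 0 := by
      rintro rfl
      exact hne (by simpa using hij)
    rw [ZMod.natCast_eq_zero_iff]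
    exact (hp.dvd_choose_pow hi (by dsimp only at hij; omega)).mul_right _
  · simp

theorem le_mod_of_not_dvd_choose {p : ℕ} (hp : p.Prime) {m a s : ℕ} (ha : a < p ^ m)
    (hs : ¬ p ∣ s.choose a) : a ≤ s % p ^ m := by
  have hmod (q r : ℕ) : (p ^ m * q + r).choose a ≡ r.choose a [MOD p] := by
    induction q with
    | zero => simp [Nat.ModEq.refl]
    | succ q ih =>
      rw [mul_add_one, add_comm (p ^ m * q), add_assoc]
      exact (choose_add_prime_pow_modEq hp ha _).trans ih
  by_contra! hlt
  have h := hmod (s / p ^ m) (s % p ^ m)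
  rw [Nat.div_add_mod, Nat.choose_eq_zero_of_lt hlt] at h
  exact hs ((Nat.modEq_zero_iff_dvd).1 h)

section ZeroSum

variable {p : ℕ} {G : Type*} [AddCommGroup G]

theorem card_lt_davenport [Fact p.Prime] {d : ℕ} (hd : augIdeal p G ^ (d + 1) = ⊥)
    (S : Multiset G) (hS : ∀ T ≤ S, T.sum = 0 → T = 0) : S.card < davenport G := by
  have hmem : davenport G ∈ {ℓ : ℕ | 0 < ℓ ∧ ∀ S : Multiset G, ℓ ≤ Multiset.card S →
      ∃ T : Multiset G, T ≤ S ∧ T ≠ 0 ∧ T.sum = 0 ∧ Multiset.card T ∈ {t | 0 < t}} := by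
    refine Nat.sInf_mem ⟨d + 1, d.succ_pos, fun S hS => ?_⟩
    obtain ⟨T, hT, hT0, hs, -⟩ := exists_zero_sum_not_dvd_choose p hd 0 S hS
    exact ⟨T, hT, hT0, hs, Multiset.card_pos.2 hT0⟩
  by_contra! hle
  obtain ⟨T, hT, hT0, hs, -⟩ := hmem.2 S hle
  exact hT0 (hS T hT hs)

theorem exponent_le_davenport [Finite G] [Fact p.Prime] {d : ℕ}
    (hd : augIdeal p G ^ (d + 1) = ⊥) : AddMonoid.exponent G ≤ davenport G := by
  obtain ⟨g, hg⟩ := AddMonoid.exists_addOrderOf_eq_exponent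
    (AddMonoid.ExponentExists.of_finite (G := G))
  have hpos : 0 < AddMonoid.exponent G := AddMonoid.exponent_pos.2 .of_finite
  have h := card_lt_davenport hd (Multiset.replicate (AddMonoid.exponent G - 1) g) ?_
  · rw [Multiset.card_replicate] at h
    omega
  · intro T hT hs
    obtain ⟨t, ht, rfl⟩ := Multiset.le_replicate_iff.1 hT
    rw [Multiset.sum_replicate] at hs
    have hdvd := addOrderOf_dvd_of_nsmul_eq_zero hs
    rw [hg] at hdvd
    rw [Nat.eq_zero_of_dvd_of_lt hdvd (by omega), Multiset.replicate_zero]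

theorem sum_lt_davenport [Fact p.Prime] {d : ℕ} (hd : augIdeal p G ^ (d + 1) = ⊥)
    {ι : Type*} [Fintype ι] [DecidableEq ι] (n : ι → ℕ) (b : ι → G) (π : ∀ i, G →+ ZMod (n i))
    (hn : ∀ i, 0 < n i) (hπ : ∀ i j, π i (b j) = if i = j then 1 else 0) :
    ∑ i, (n i - 1) < davenport G := by
  classical
  have h := card_lt_davenport hd (∑ i, Multiset.replicate (n i - 1) (b i)) ?_
  · simpa using h
  intro T hT hs
  obtain ⟨I, hI, rfl⟩ : ∃ I ≤ ∑ i, Multiset.replicate (n i - 1) i, I.map b = T := by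
    have hmap : (∑ i, Multiset.replicate (n i - 1) i).map b =
        ∑ i, Multiset.replicate (n i - 1) (b i) := by
      rw [← Multiset.coe_mapAddMonoidHom, map_sum]
      simp
    exact Multiset.exists_le_map_eq_of_le_map (hmap ▸ hT)
  suffices I = 0 by simp [this]
  ext i
  have hle : I.count i ≤ n i - 1 := by
    refine (Multiset.count_le_of_le i hI).trans (le_of_eq ?_)
    simp [Multiset.count_sum', Multiset.count_replicate]
  have hz : ((I.count i : ℕ) : ZMod (n i)) = 0 := by
    have h := congrArg (π i) hs
    rw [map_multiset_sum, Multiset.map_map, map_zero] at h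
    rw [← h, ← Multiset.sum_map_ite_eq_count]
    simp [hπ]
  rw [ZMod.natCast_eq_zero_iff] at hz
  have := hn i
  rw [Nat.eq_zero_of_dvd_of_lt hz (by omega), Multiset.count_zero]

/-- For a finite abelian `p`-group, the augmentation ideal of the group algebra over `ZMod p`
has nilpotency index at most the Davenport constant. -/
theorem augIdeal_pow_davenport [Finite G] [Fact p.Prime] (hpG : ∀ g : G, ∃ k : ℕ, p ^ k • g = 0) :
    ∃ d, augIdeal p G ^ (d + 1) = ⊥ ∧ d < davenport G := by
  classical
  have hp : p.Prime := Fact.out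
  obtain ⟨ι, _, q, hq, f, ⟨E⟩⟩ := AddCommGroup.equiv_directSum_zmod_of_finite G
  let b (i : ι) : G := E.symm (DirectSum.of (fun i => ZMod (q i ^ f i)) i 1)
  let π (i : ι) : G →+ ZMod (q i ^ f i) :=
    (DFinsupp.evalAddMonoidHom i).comp E.toAddMonoidHom
  have hπ (i j : ι) : π i (b j) = if i = j then 1 else 0 := by
    have h : π i (b j) = DirectSum.of (fun i => ZMod (q i ^ f i)) j 1 i := by
      change E (E.symm _) i = _
      rw [E.apply_symm_apply]
    rw [h]
    split_ifs with hij
    · subst hij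
      exact DirectSum.of_eq_same _ _
    · exact DirectSum.of_eq_of_ne _ _ _ hij
  have hpow (i : ι) : ∃ e, q i ^ f i = p ^ e := by
    obtain ⟨k, hk⟩ := hpG (b i)
    have h := congrArg (π i) hk
    rw [map_nsmul, hπ, if_pos rfl, map_zero, nsmul_one, ZMod.natCast_eq_zero_iff,
      Nat.dvd_prime_pow hp] at h
    exact ⟨h.choose, h.choose_spec.2⟩
  choose e he using hpow
  have hb0 (i : ι) : p ^ e i • b i = 0 := by
    rw [← he i, ← map_nsmul, ← map_nsmul, nsmul_one, ZMod.natCast_self, map_zero, map_zero]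
  have hclosure : AddSubgroup.closure (Set.range b) = ⊤ := by
    refine eq_top_iff.2 fun g _ => ?_
    obtain ⟨x, rfl⟩ := E.symm.surjective g
    induction x using DirectSum.induction_on with
    | zero => simp
    | of i z =>
      have hz : DirectSum.of (fun i => ZMod (q i ^ f i)) i z = z.val •
          DirectSum.of (fun i => ZMod (q i ^ f i)) i 1 := by
        have : NeZero (q i ^ f i) := ⟨pow_ne_zero _ (hq i).ne_zero⟩
        rw [← map_nsmul, nsmul_one, ZMod.natCast_zmod_val]
      rw [hz, map_nsmul]
      exact nsmul_mem (AddSubgroup.subset_closure (Set.mem_range_self i)) _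
    | add x y hx hy =>
      rw [map_add]
      exact add_mem (hx trivial) (hy trivial)
  have hd := augIdeal_pow_eq_bot b e hclosure hb0
  refine ⟨∑ i, (p ^ e i - 1), hd, ?_⟩
  simp only [← he]
  exact sum_lt_davenport hd _ b π (fun i => pow_pos (hq i).pos _) hπ

theorem exponent_eq_prime_pow [Finite G] (hp : p.Prime)
    (hpG : ∀ g : G, ∃ k : ℕ, p ^ k • g = 0) : ∃ m, AddMonoid.exponent G = p ^ m := by
  obtain ⟨g, hg⟩ := AddMonoid.exists_addOrderOf_eq_exponent
    (AddMonoid.ExponentExists.of_finite (G := G))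
  obtain ⟨k, hk⟩ := hpG g
  obtain ⟨m, -, hm⟩ := (Nat.dvd_prime_pow hp).1 (addOrderOf_dvd_of_nsmul_eq_zero hk)
  exact ⟨m, hg ▸ hm⟩

theorem exists_zero_sum_card_mem_of_sum_eq_zero [Fact p.Prime] {d m k : ℕ}
    (hd : augIdeal p G ^ (d + 1) = ⊥) (hk : d + 1 ≤ p ^ m + k) (R : Multiset G) (y : ℕ)
    (hR : R.sum = 0) (hcard : R.card + y = 2 * p ^ m) (hy : y + k + 1 ≤ p ^ m) :
    ∃ V ≤ R, V.sum = 0 ∧ p ^ m ≤ V.card + k + y ∧ V.card ≤ p ^ m := by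
  induction hr : R.card using Nat.strong_induction_on generalizing R y with
  | _ r ih =>
  obtain ⟨x, hx⟩ := Multiset.card_pos_iff_exists_mem.1 (show 0 < R.card by omega)
  obtain ⟨R', rfl⟩ := Multiset.exists_cons_of_mem hx
  rw [Multiset.card_cons] at hr hcard
  obtain ⟨V, hV, hV0, hVs, hdvd⟩ := exists_zero_sum_not_dvd_choose p hd (p ^ m - k - 1 - y) R'
    (by omega)
  have hmod := le_mod_of_not_dvd_choose Fact.out (m := m) (by omega) hdvd
  have hVpos := Multiset.card_pos.2 hV0
  have hVR := Multiset.card_le_card hV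
  have hle : V ≤ x ::ₘ R' := hV.trans (Multiset.le_cons_self R' x)
  have hmod_le := Nat.mod_le (V.card - 1) (p ^ m)
  by_cases hVn : V.card ≤ p ^ m
  · exact ⟨V, hle, hVs, by omega, hVn⟩
  rw [Nat.mod_eq_sub_mod (by omega), Nat.mod_eq_of_lt (by omega)] at hmod
  obtain ⟨B, hB⟩ := Multiset.le_iff_exists_add.1 hle
  have hBcard := congrArg Multiset.card hB
  have hBs := congrArg Multiset.sum hB
  rw [Multiset.sum_add, hR, hVs, zero_add] at hBs
  rw [Multiset.card_add, Multiset.card_cons] at hBcard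
  by_cases hBn : p ^ m ≤ B.card + k + y
  · exact ⟨B, hB ▸ Multiset.le_add_left B V, hBs.symm, hBn, by omega⟩
  obtain ⟨W, hW, hWs, hW1, hW2⟩ := ih V.card (by omega) V (y + B.card) hVs (by omega) (by omega) rfl
  by_cases hWn : p ^ m ≤ W.card + k + y
  · exact ⟨W, hW.trans hle, hWs, hWn, hW2⟩
  · refine ⟨W + B, hB ▸ add_le_add_left hW B, ?_, ?_, ?_⟩
    · rw [Multiset.sum_add, hWs, ← hBs, add_zero]
    · rw [Multiset.card_add]
      omega
    · rw [Multiset.card_add]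
      omega

theorem exists_zero_sum_card_mem [Fact p.Prime] {d m k : ℕ}
    (hd : augIdeal p G ^ (d + 1) = ⊥) (hk : d + 1 ≤ p ^ m + k) (hkm : k + 1 ≤ p ^ m)
    (S : Multiset G) (hS : 2 * p ^ m + k - 1 ≤ S.card) :
    ∃ T ≤ S, T.sum = 0 ∧ p ^ m ≤ T.card + k ∧ T.card ≤ p ^ m := by
  obtain ⟨S', hS', hcard⟩ := show ∃ S' ≤ S, S'.card = 2 * p ^ m + k - 1 from
    ⟨S.toList.take (2 * p ^ m + k - 1),
      (Multiset.coe_le.2 (List.take_sublist _ _).subperm).trans (Multiset.coe_toList S).le,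
      by simpa using hS⟩
  obtain ⟨T, hT, hT0, hTs, hdvd⟩ := exists_zero_sum_not_dvd_choose p hd (p ^ m - 1) S' (by omega)
  have hmod := le_mod_of_not_dvd_choose Fact.out (m := m) (by omega) hdvd
  have hTpos := Multiset.card_pos.2 hT0
  have hTS := Multiset.card_le_card hT
  have hmod_le := Nat.mod_le (T.card - 1) (p ^ m)
  by_cases hTn : T.card ≤ p ^ m
  · exact ⟨T, hT.trans hS', hTs, by omega, hTn⟩
  have hT2 : T.card = 2 * p ^ m := by
    rw [Nat.mod_eq_sub_mod (by omega)] at hmod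
    have hmod_le' := Nat.mod_le (T.card - 1 - p ^ m) (p ^ m)
    by_contra hne
    rw [Nat.mod_eq_sub_mod (by omega), Nat.mod_eq_of_lt (by omega)] at hmod
    omega
  obtain ⟨V, hV, h⟩ := exists_zero_sum_card_mem_of_sum_eq_zero hd hk T 0 hTs (by omega) (by omega)
  exact ⟨V, hV.trans (hT.trans hS'), by simpa using h⟩

end ZeroSum

/-- For a finite abelian `p`-group `G` with `D(G) ≤ 2n − 1` (`n = exp(G)`),
every sequence over `G` of length at least `D(G) + n − 1` contains a nonempty zero-sum
subsequence whose length `t` satisfies `2n − D(G) ≤ t ≤ n`; that is,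
`η_{2n−D(G)}(G) ≤ D(G) + n − 1`. -/
theorem stmt6 (p : ℕ) (hp : p.Prime) (G : Type*) [AddCommGroup G] [Finite G]
    (hpG : ∀ g : G, ∃ k : ℕ, p ^ k • g = 0)
    (hD : davenport G ≤ 2 * AddMonoid.exponent G - 1) :
    (∀ S : Multiset G, davenport G + AddMonoid.exponent G - 1 ≤ Multiset.card S →
      ∃ T : Multiset G, T ≤ S ∧ T ≠ 0 ∧ T.sum = 0 ∧
        2 * AddMonoid.exponent G - davenport G ≤ Multiset.card T ∧
        Multiset.card T ≤ AddMonoid.exponent G) ∧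
    etaI G (2 * AddMonoid.exponent G - davenport G) ≤
      davenport G + AddMonoid.exponent G - 1 := by
  have := Fact.mk hp
  obtain ⟨d, hd, hdD⟩ := augIdeal_pow_davenport hpG
  have hnD := exponent_le_davenport hd
  obtain ⟨m, hm⟩ := exponent_eq_prime_pow hp hpG
  have hpos : 0 < p ^ m := pow_pos hp.pos m
  rw [hm] at hD hnD
  have main : ∀ S : Multiset G, davenport G + AddMonoid.exponent G - 1 ≤ Multiset.card S →
      ∃ T : Multiset G, T ≤ S ∧ T ≠ 0 ∧ T.sum = 0 ∧
        2 * AddMonoid.exponent G - davenport G ≤ Multiset.card T ∧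
        Multiset.card T ≤ AddMonoid.exponent G := by
    rw [hm]
    intro S hS
    obtain ⟨T, hT, hTs, h1, h2⟩ := exists_zero_sum_card_mem (m := m) (k := davenport G - p ^ m) hd
      (by omega) (by omega) S (by omega)
    refine ⟨T, hT, ?_, hTs, by omega, h2⟩
    rintro rfl
    rw [Multiset.card_zero] at h1
    omega
  exact ⟨main, Nat.sInf_le ⟨by rw [hm]; omega, main⟩⟩
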